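/- Let X be a complex Banach space, n ≥ 1, f : [0,∞)^n → X locally Bochner integrable, and let G(t₁,…,tₙ) = ∫₀^{t₁}…∫₀^{tₙ} f(s₁,…,sₙ) ds₁…dsₙ. If λ⁰ = (λ₁⁰,…,λₙ⁰) ∈ Ω_b(f), then there exists M > 0 such that for all t₁ ≥ 0, …, tₙ ≥ 0: ‖G(t₁,…,tₙ)‖ ≤ M · Σ_{S ⊆ {1,…,n}} ∏_{j ∈ S} e^{(Re λⱼ⁰)·tⱼ} · ∏_{j ∉ S} ∫₀^{tⱼ} e^{(Re λⱼ⁰)·s} ds (a sum of 2ⁿ terms, where in each term aⱼ(tⱼ) is either e^{(Re λⱼ⁰)tⱼ} or ∫₀^{tⱼ} e^{(Re λⱼ⁰)s} ds). -/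

import Mathlib

open MeasureTheory Set Filter

noncomputable section

/-- The nonnegative orthant `[0,∞)^n`. -/
def orthant (n : ℕ) : Set (Fin n → ℝ) := {t | ∀ j, 0 ≤ t j}

/-- The box `[0,t₁] × … × [0,tₙ]`. -/
def box {n : ℕ} (t : Fin n → ℝ) : Set (Fin n → ℝ) := Set.univ.pi fun j => Set.Icc 0 (t j)

variable {X : Type*} [NormedAddCommGroup X] [NormedSpace ℂ X]

/-- The Laplace kernel `t ↦ e^{-λ₁t₁-…-λₙtₙ} f(t)`. -/
def lapKer {n : ℕ} (lam : Fin n → ℂ) (f : (Fin n → ℝ) → X) : (Fin n → ℝ) → X :=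
  fun t => Complex.exp (-(∑ j, lam j * (t j : ℂ))) • f t

/-- Absolute convergence of the Laplace integral at `lam`: membership in `Ω_abs(f)`. -/
def OmegaAbs {n : ℕ} (f : (Fin n → ℝ) → X) (lam : Fin n → ℂ) : Prop :=
  IntegrableOn (lapKer lam f) (orthant n)

/-- The (absolutely convergent) Laplace transform `(Lf)(λ)`. -/
def lapTr {n : ℕ} (f : (Fin n → ℝ) → X) (lam : Fin n → ℂ) : X :=
  ∫ t in orthant n, lapKer lam f t

/-- The truncated Laplace integral `I(f,λ,t)`. -/
def truncInt {n : ℕ} (f : (Fin n → ℝ) → X) (lam : Fin n → ℂ) (t : Fin n → ℝ) : X :=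
  ∫ s in box t, lapKer lam f s

/-- Convergence of the Laplace integral at `lam` with value `F`. -/
def LapConvTo {n : ℕ} (f : (Fin n → ℝ) → X) (lam : Fin n → ℂ) (F : X) : Prop :=
  ∀ ε > 0, ∃ M > 0, ∀ t : Fin n → ℝ, (∀ j, M < t j) → ‖truncInt f lam t - F‖ < ε

/-- Convergence of the Laplace integral at `lam`: membership in `Ω(f)`. -/
def OmegaConv {n : ℕ} (f : (Fin n → ℝ) → X) (lam : Fin n → ℂ) : Prop :=
  ∃ F, LapConvTo f lam F

/-- Boundedness of all truncated Laplace integrals: membership in `Ω_b(f)`. -/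
def OmegaBdd {n : ℕ} (f : (Fin n → ℝ) → X) (lam : Fin n → ℂ) : Prop :=
  ∃ C, ∀ t : Fin n → ℝ, ‖truncInt f lam t‖ ≤ C

/-- Local Bochner integrability on `[0,∞)^n`. -/
def LocInt {n : ℕ} (f : (Fin n → ℝ) → X) : Prop :=
  ∀ t : Fin n → ℝ, IntegrableOn f (box t)

/-- The Dirac mass at `t` plus Lebesgue measure on `[0,t)`. -/
def endpointMeasure (t : ℝ) : Measure ℝ := Measure.dirac t + volume.restrict (Ico 0 t)

instance (t : ℝ) : IsFiniteMeasure (endpointMeasure t) := by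
  unfold endpointMeasure; infer_instance

/-- The density with respect to `endpointMeasure t` whose tail integrals over `[s,∞)`
are `e^{zs}`. -/
def expDensity (z : ℂ) (t r : ℝ) : ℂ :=
  if r = t then Complex.exp (z * t) else -(z * Complex.exp (z * r))

lemma expDensity_of_lt (z : ℂ) {t r : ℝ} (h : r < t) :
    expDensity z t r = -(z * Complex.exp (z * r)) := if_neg h.ne

lemma continuous_mul_exp (z : ℂ) : Continuous fun r : ℝ => -(z * Complex.exp (z * r)) := by
  fun_prop

lemma integrableOn_expDensity (z : ℂ) (t : ℝ) :
    IntegrableOn (expDensity z t) (Ico 0 t) :=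
  (((continuous_mul_exp z).integrableOn_Icc (a := 0) (b := t)).mono_set
    Ico_subset_Icc_self).congr_fun (fun _ hr => (expDensity_of_lt z hr.2).symm) measurableSet_Ico

lemma integrable_expDensity (z : ℂ) (t : ℝ) :
    Integrable (expDensity z t) (endpointMeasure t) :=
  (integrable_dirac (by simp)).add_measure (integrableOn_expDensity z t)

lemma integral_indicator_expDensity (z : ℂ) {s t : ℝ} (hs : 0 ≤ s) (hst : s ≤ t) :
    ∫ r, (Ici s).indicator (expDensity z t) r ∂endpointMeasure t = Complex.exp (z * s) := by
  have hderiv : ∀ r : ℝ, HasDerivAt (fun r : ℝ => -Complex.exp (z * r))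
      (-(z * Complex.exp (z * r))) r := fun r => by
    have h := (((hasDerivAt_id (r : ℂ)).const_mul z).cexp.neg).comp_ofReal
    convert h using 1
    · rfl
    · simp [mul_comm]
  have hftc := intervalIntegral.integral_eq_sub_of_hasDerivAt (a := s) (b := t)
    (fun r _ => hderiv r) ((continuous_mul_exp z).intervalIntegrable _ _)
  rw [endpointMeasure, integral_add_measure
    ((integrable_dirac (by simp)).indicator measurableSet_Ici)
    ((integrableOn_expDensity z t).integrable.indicator measurableSet_Ici), integral_dirac,
    indicator_of_mem (mem_Ici.2 hst), setIntegral_indicator measurableSet_Ici]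
  have hset : Ico 0 t ∩ Ici s = Ico s t := by
    ext r; simp only [mem_inter_iff, mem_Ico, mem_Ici]
    exact ⟨fun h => ⟨h.2, h.1.2⟩, fun h => ⟨⟨hs.trans h.1, h.2⟩, h.1⟩⟩
  rw [hset, setIntegral_congr_fun measurableSet_Ico
    (fun r hr => expDensity_of_lt z hr.2), integral_Ico_eq_integral_Ioc,
    ← intervalIntegral.integral_of_le hst, hftc, expDensity, if_pos rfl]
  ring

lemma integral_norm_expDensity (z : ℂ) {t : ℝ} (ht : 0 ≤ t) :
    ∫ r, ‖expDensity z t r‖ ∂endpointMeasure t =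
      Real.exp (z.re * t) + ‖z‖ * ∫ r in (0:ℝ)..t, Real.exp (z.re * r) := by
  rw [endpointMeasure, integral_add_measure (integrable_dirac (by simp)).norm
    (integrableOn_expDensity z t).integrable.norm, integral_dirac,
    setIntegral_congr_fun (g := fun r : ℝ => ‖z‖ * Real.exp (z.re * r)) measurableSet_Ico
    (fun r hr => by simp [expDensity_of_lt z hr.2, Complex.norm_exp]),
    integral_Ico_eq_integral_Ioc, ← intervalIntegral.integral_of_le ht,
    intervalIntegral.integral_const_mul]
  simp [expDensity, Complex.norm_exp]

lemma box_inter_Iic {n : ℕ} (t r : Fin n → ℝ) : box t ∩ Iic r = box (t ⊓ r) := by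
  ext s
  simp only [box, mem_inter_iff, mem_univ_pi, mem_Icc, mem_Iic, Pi.le_def, Pi.inf_apply,
    le_inf_iff]
  exact ⟨fun h j => ⟨(h.1 j).1, (h.1 j).2, h.2 j⟩,
    fun h => ⟨fun j => ⟨(h j).1, (h j).2.1⟩, fun j => (h j).2.2⟩⟩

lemma measurableSet_box {n : ℕ} (t : Fin n → ℝ) : MeasurableSet (box t) :=
  MeasurableSet.univ_pi fun _ => measurableSet_Icc

lemma LocInt.lapKer {n : ℕ} {f : (Fin n → ℝ) → X} (hf : LocInt f) (lam : Fin n → ℂ) :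
    LocInt (lapKer lam f) := fun t =>
  (hf t).continuousOn_smul (f := fun s => Complex.exp (-(∑ j, lam j * (s j : ℂ))))
    (by fun_prop) (isCompact_univ_pi fun _ => isCompact_Icc)

/-- Iterated integration by parts: the antiderivative of `f` as an integral of truncated Laplace
integrals. -/
lemma integral_box_eq_integral_truncInt [CompleteSpace X] {n : ℕ} {f : (Fin n → ℝ) → X}
    (hf : LocInt f) (lam : Fin n → ℂ) (t : Fin n → ℝ) :
    ∫ s in box t, f s = ∫ r, (∏ j, expDensity (lam j) (t j) (r j)) • truncInt f lam (t ⊓ r)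
      ∂Measure.pi fun j => endpointMeasure (t j) := by
  set ν := Measure.pi fun j => endpointMeasure (t j)
  let H : (Fin n → ℝ) → ℂ := fun r => ∏ j, expDensity (lam j) (t j) (r j)
  have hH : Integrable H ν := Integrable.fintype_prod fun j => integrable_expDensity _ _
  have hle : MeasurableSet {p : (Fin n → ℝ) × (Fin n → ℝ) | p.1 ≤ p.2} :=
    (isClosed_le continuous_fst continuous_snd).measurableSet
  let F : (Fin n → ℝ) × (Fin n → ℝ) → X :=
    {p | p.1 ≤ p.2}.indicator fun p => H p.2 • lapKer lam f p.1
  have hF : Integrable F ((volume.restrict (box t)).prod ν) := by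
    refine Integrable.indicator ?_ hle
    exact (hH.smul_prod (hf.lapKer lam t).integrable).swap
  have hinner : ∀ s ∈ box t, f s = ∫ r, F (s, r) ∂ν := fun s hs => by
    have hs' : ∀ j, 0 ≤ s j ∧ s j ≤ t j := fun j => hs j (mem_univ j)
    have hFs : ∀ r, F (s, r) =
        (∏ j, (Ici (s j)).indicator (expDensity (lam j) (t j)) (r j)) • lapKer lam f s := by
      intro r
      by_cases h : s ≤ r
      · simp only [F, indicator_of_mem (show (s, r) ∈ {p : (Fin n → ℝ) × (Fin n → ℝ) |
          p.1 ≤ p.2} from h), H]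
        congr 1
        exact Finset.prod_congr rfl fun j _ => (indicator_of_mem (mem_Ici.2 (h j)) _).symm
      · obtain ⟨j, hj⟩ : ∃ j, ¬ s j ≤ r j := by simpa [Pi.le_def] using h
        rw [Finset.prod_eq_zero (Finset.mem_univ j) (indicator_of_notMem hj _), zero_smul]
        exact indicator_of_notMem (by exact h) _
    simp_rw [hFs]
    rw [integral_smul_const, integral_fintype_prod_eq_prod,
      Finset.prod_congr rfl fun j _ =>
        integral_indicator_expDensity (lam j) (hs' j).1 (hs' j).2,
      ← Complex.exp_sum, _root_.lapKer, smul_smul, ← Complex.exp_add, add_neg_cancel,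
      Complex.exp_zero, one_smul]
  rw [setIntegral_congr_fun (measurableSet_box t) hinner,
    integral_integral_swap (f := fun s r => F (s, r)) hF]
  refine integral_congr_ae (ae_of_all _ fun r => ?_)
  have hFr : ∀ s, F (s, r) = (Iic r).indicator (fun s => H r • lapKer lam f s) s :=
    fun s => rfl
  simp only [hFr]
  rw [setIntegral_indicator measurableSet_Iic, box_inter_Iic, integral_smul, truncInt]

/-- If `λ⁰ ∈ Ω_b(f)`, then the antiderivative `G` of `f` satisfies the `2ⁿ`-term bound
`‖G(t)‖ ≤ M · Σ_{S ⊆ {1,…,n}} ∏_{j∈S} e^{(Re λⱼ⁰)tⱼ} ∏_{j∉S} ∫₀^{tⱼ} e^{(Re λⱼ⁰)s} ds`. -/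
theorem antiderivative_bound_of_omegaBdd [CompleteSpace X]
    (n : ℕ) (hn : 1 ≤ n) (f : (Fin n → ℝ) → X) (hf : LocInt f)
    (lam0 : Fin n → ℂ) (h0 : OmegaBdd f lam0) :
    ∃ M > 0, ∀ t : Fin n → ℝ, (∀ j, 0 ≤ t j) →
      ‖∫ s in box t, f s‖ ≤ M * ∑ S : Finset (Fin n),
        (∏ j ∈ S, Real.exp ((lam0 j).re * t j)) *
          ∏ j ∈ Sᶜ, ∫ s in (0:ℝ)..(t j), Real.exp ((lam0 j).re * s) := by
  obtain ⟨C, hC⟩ := h0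
  have hC0 : 0 ≤ C := (norm_nonneg _).trans (hC 0)
  refine ⟨(C + 1) * ∏ j, (1 + ‖lam0 j‖), mul_pos (by positivity)
    (Finset.prod_pos fun j _ => by positivity), fun t ht => ?_⟩
  set ν := Measure.pi fun j => endpointMeasure (t j)
  have hH : Integrable (fun r : Fin n → ℝ => ∏ j, expDensity (lam0 j) (t j) (r j)) ν :=
    Integrable.fintype_prod fun j => integrable_expDensity _ _
  rw [integral_box_eq_integral_truncInt hf lam0 t, ← Fintype.prod_add, mul_assoc,
    ← Finset.prod_mul_distrib]
  calc _ ≤ ∫ r, ‖∏ j, expDensity (lam0 j) (t j) (r j)‖ * C ∂ν :=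
        norm_integral_le_of_norm_le (hH.norm.mul_const C) <| ae_of_all _ fun r => by
          rw [norm_smul]
          exact mul_le_mul_of_nonneg_left (hC _) (norm_nonneg _)
    _ = C * ∏ j, (Real.exp ((lam0 j).re * t j) +
          ‖lam0 j‖ * ∫ s in (0:ℝ)..(t j), Real.exp ((lam0 j).re * s)) := by
        simp_rw [norm_prod]
        rw [integral_mul_const, integral_fintype_prod_eq_prod
          (f := fun j r => ‖expDensity (lam0 j) (t j) r‖), mul_comm]
        exact congrArg _ (Finset.prod_congr rfl fun j _ => integral_norm_expDensity _ (ht j))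
    _ ≤ _ := by
        have hI : ∀ j, 0 ≤ ∫ s in (0:ℝ)..(t j), Real.exp ((lam0 j).re * s) := fun j =>
          intervalIntegral.integral_nonneg (ht j) fun _ _ => (Real.exp_pos _).le
        have hnn : ∀ j, 0 ≤ Real.exp ((lam0 j).re * t j) +
            ‖lam0 j‖ * ∫ s in (0:ℝ)..(t j), Real.exp ((lam0 j).re * s) := fun j =>
          add_nonneg (Real.exp_pos _).le (mul_nonneg (norm_nonneg _) (hI j))
        refine mul_le_mul (by linarith) (Finset.prod_le_prod (fun j _ => hnn j) fun j _ => ?_)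
          (Finset.prod_nonneg fun j _ => hnn j) (by linarith)
        nlinarith [hI j, mul_nonneg (norm_nonneg (lam0 j)) (Real.exp_pos ((lam0 j).re * t j)).le]
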